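/- arXiv:1705.04829 — 3 statements merged into one kernel-verified Lean document; each statement's English description precedes it below -/
import Mathlib

section
/- Let d ≥ 1, let a, b ∈ ℝᵈ (with the Euclidean inner product ⟨·,·⟩ and norm ‖·‖), and let n ∈ ℝ. Define the upwind value {∇v}ᵘᵖ := a if n ≥ 0 and b if n < 0. Then ⟨{∇v}ᵘᵖ, n • a + (−n) • b⟩ − (1/2)·n·(‖a‖² − ‖b‖²) = (1/2)·|n|·‖a − b‖². -/
open RealInnerProductSpace

/-- Vector-valued analogue of identity (3.24) of Lemma 2, for the gradient terms
in the coercivity proof of Lemma 4. -/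
theorem upwind_jump_identity_vector
    (d : ℕ) (hd : 1 ≤ d) (a b : EuclideanSpace ℝ (Fin d)) (n : ℝ) :
    ⟪(if n ≥ 0 then a else b), n • a + (-n) • b⟫
      - (1 / 2) * n * (‖a‖ ^ 2 - ‖b‖ ^ 2)
      = (1 / 2) * |n| * ‖a - b‖ ^ 2 := by
  rw [norm_sub_sq_real]
  split_ifs with h
  · rw [abs_of_nonneg h, inner_add_right, real_inner_smul_right, real_inner_smul_right,
      real_inner_self_eq_norm_sq]
    ring
  · rw [abs_of_neg (not_le.mp h), inner_add_right, real_inner_smul_right, real_inner_smul_right,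
      real_inner_self_eq_norm_sq, real_inner_comm a b]
    ring
end

section
/- Let n ∈ ℝ with |n| ≤ 1 and let vᵢ, vⱼ ∈ ℝ. With the upwind value {v}ᵘᵖ := vᵢ if n ≥ 0 and vⱼ if n < 0, one has the lower bound {v}ᵘᵖ · (vᵢ·n + vⱼ·(−n)) − (1/2)·(vᵢ²·n + vⱼ²·(−n)) ≥ (1/2)·(vᵢ·n + vⱼ·(−n))², i.e. {v}ᵘᵖ⟦v⟧ₜ − (1/2)⟦v²⟧ₜ ≥ (1/2)(⟦v⟧ₜ)². -/
/-- Key step of the coercivity Lemma 4: {v}ᵘᵖ⟦v⟧ₜ − (1/2)⟦v²⟧ₜ ≥ (1/2)(⟦v⟧ₜ)²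
for a unit-normal time component |n| ≤ 1. -/
theorem upwind_jump_lower_bound (n vi vj : ℝ) (hn : |n| ≤ 1) :
    (if n ≥ 0 then vi else vj) * (vi * n + vj * (-n))
      - (1 / 2) * (vi ^ 2 * n + vj ^ 2 * (-n))
      ≥ (1 / 2) * (vi * n + vj * (-n)) ^ 2 := by
  obtain ⟨h1, h2⟩ := abs_le.mp hn
  split_ifs with h
  · have h3 : 0 ≤ n * (1 - n) := mul_nonneg h (by linarith)
    have h4 := mul_nonneg h3 (sq_nonneg (vi - vj))
    linarith
  · have h3 : 0 ≤ (-n) * (1 + n) := mul_nonneg (by linarith) (by linarith)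
    have h4 := mul_nonneg h3 (sq_nonneg (vi - vj))
    linarith
end

section
/- Let d ≥ 1, let a, b ∈ ℝᵈ (with Euclidean inner product and norm), and let n ∈ ℝ with |n| ≤ 1. With the upwind value {∇v}ᵘᵖ := a if n ≥ 0 and b if n < 0, one has ⟨{∇v}ᵘᵖ, n • a + (−n) • b⟩ − (1/2)·n·(‖a‖² − ‖b‖²) ≥ (1/2)·‖n • a + (−n) • b‖². -/
open RealInnerProductSpace

/-- Gradient-term analogue of the key step in the coercivity proof of Lemma 4. -/
theorem upwind_jump_lower_bound_vector
    (d : ℕ) (hd : 1 ≤ d) (a b : EuclideanSpace ℝ (Fin d)) (n : ℝ) (hn : |n| ≤ 1) :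
    ⟪(if n ≥ 0 then a else b), n • a + (-n) • b⟫
      - (1 / 2) * n * (‖a‖ ^ 2 - ‖b‖ ^ 2)
      ≥ (1 / 2) * ‖n • a + (-n) • b‖ ^ 2 := by
  have e : n • a + (-n) • b = n • (a - b) := by
    rw [smul_sub, neg_smul, sub_eq_add_neg]
  have h1 : ‖n • (a - b)‖ ^ 2 = n ^ 2 * ‖a - b‖ ^ 2 := by
    rw [norm_smul, mul_pow, Real.norm_eq_abs, sq_abs]
  have h2 := norm_sub_sq_real a b
  have h3 := sq_nonneg ‖a - b‖
  obtain ⟨hl, hu⟩ := abs_le.mp hn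
  rw [e, h1, real_inner_smul_right, inner_sub_right]
  split_ifs with h
  · rw [real_inner_self_eq_norm_sq]
    have h4 : 0 ≤ (n * (1 - n)) * ‖a - b‖ ^ 2 :=
      mul_nonneg (mul_nonneg h (by linarith)) h3
    have h5 : n * ‖a - b‖ ^ 2 = n * (‖a‖ ^ 2 - 2 * inner ℝ a b + ‖b‖ ^ 2) := by rw [h2]
    linarith
  · rw [real_inner_self_eq_norm_sq, real_inner_comm]
    have h4 : 0 ≤ ((-n) * (1 + n)) * ‖a - b‖ ^ 2 :=
      mul_nonneg (mul_nonneg (by linarith) (by linarith)) h3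
    have h5 : n * ‖a - b‖ ^ 2 = n * (‖a‖ ^ 2 - 2 * inner ℝ a b + ‖b‖ ^ 2) := by rw [h2]
    linarith
end
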